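/- arXiv:2403.02207 — 2 statements merged into one kernel-verified Lean document; each statement's English description precedes it below -/
import Mathlib

section
/- Let H be a separable complex Hilbert space, C a conjugation on H, and T a bounded linear operator on H with |T| = (T*T)^{1/2}. Then T is C-normal if and only if there exists an anti-linear map J on H such that: J vanishes on the orthogonal complement of ran(|T|), J maps the closure of ran(|T|) isometrically onto the closure of ran(|T|) (J is a partial anti-unitary supported on ran(|T|)), T = C ∘ J ∘ |T|, and J ∘ |T| = |T| ∘ J. -/
open scoped InnerProductSpace
open ContinuousLinearMap TopologicalSpace

/-- A conjugation on a complex Hilbert space: an anti-linear, involutive map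
satisfying `⟪C x, C y⟫ = ⟪y, x⟫`. -/
def Conjugation {K : Type*} [NormedAddCommGroup K] [InnerProductSpace ℂ K] (C : K → K) : Prop :=
  (∀ (a : ℂ) (x y : K), C (a • x + y) = (starRingEnd ℂ) a • C x + C y) ∧
  (∀ x, C (C x) = x) ∧
  (∀ x y : K, ⟪C x, C y⟫_ℂ = ⟪y, x⟫_ℂ)

/-- `T` is `C`-normal: `C T*T C = T T*` (pointwise). -/
def CNormal {K : Type*} [NormedAddCommGroup K] [InnerProductSpace ℂ K] [CompleteSpace K]
    (C : K → K) (T : K →L[ℂ] K) : Prop :=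
  ∀ x, C (adjoint T (T (C x))) = T (adjoint T x)

theorem aux_intertwine {A : Type*} [CStarAlgebra A] [PartialOrder A] [StarOrderedRing A]
    (q p t : A) (hq : 0 ≤ q) (hp : 0 ≤ p) (h : q * (q * t) = t * (p * p)) : q * t = t * p := by
  have hqs : star q = q := (IsSelfAdjoint.of_nonneg hq).star_eq
  have hps : star p = p := (IsSelfAdjoint.of_nonneg hp).star_eq
  obtain ⟨x, hx⟩ : ∃ x, x = q * t - t * p := ⟨_, rfl⟩
  have h1 : q * x = -(x * p) := by
    rw [hx, mul_sub, sub_mul, h]; noncomm_ring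
  have h2 : star x * x * p = -(star x * q * x) := by
    rw [mul_assoc (star x) q x, h1]; noncomm_ring
  have hb : 0 ≤ star x * q * x := star_left_conjugate_nonneg hq x
  have hcomm : Commute (star x * x) p := by
    have h3 := congrArg star h2
    rw [star_neg] at h3
    simp only [star_mul, star_star, hqs, hps] at h3
    have h4 : p * (star x * x) = -(star x * q * x) := by
      rw [h3]; noncomm_ring
    exact h2.trans h4.symm
  have hn : 0 ≤ star x * x * p := Commute.mul_nonneg (star_mul_self_nonneg x) hp hcomm
  have h0 : star x * x * p = 0 := by
    refine le_antisymm ?_ hn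
    rw [h2]; simpa using hb
  have hxp : x * p = 0 := by
    rw [← CStarRing.star_mul_self_eq_zero_iff]
    rw [star_mul, hps]
    calc p * star x * (x * p) = p * (star x * x * p) := by noncomm_ring
      _ = 0 := by rw [h0, mul_zero]
  have hqx : q * x = 0 := by rw [h1, hxp, neg_zero]
  have hxq : star x * q = 0 := by
    have := congrArg star hqx
    simpa [hqs] using this
  have hpx : p * star x = 0 := by
    have := congrArg star hxp
    simpa [hps] using this
  have h5 : star x * (x * star x) = 0 := by
    have : x * star x = q * t * star x := by
      nth_rewrite 1 [hx]
      rw [sub_mul, mul_assoc t p, hpx]; simp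
    rw [this, ← mul_assoc, ← mul_assoc, hxq]; simp
  have h6 : x * star x = 0 := by
    rw [← CStarRing.star_mul_self_eq_zero_iff]
    rw [star_mul, star_star, mul_assoc, h5, mul_zero]
  have h7 : x = 0 := by
    rwa [CStarRing.mul_star_self_eq_zero_iff] at h6
  rw [h7] at hx
  exact (sub_eq_zero.mp hx.symm)

theorem aux_polar {H : Type*} [NormedAddCommGroup H] [InnerProductSpace ℂ H] [CompleteSpace H]
    (T P : H →L[ℂ] H) (hn : ∀ x, ‖T x‖ = ‖P x‖) :
    ∃ U : H →L[ℂ] H, (∀ x, U (P x) = T x) ∧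
      (∀ x : H, (∀ y : H, ⟪x, P y⟫_ℂ = 0) → U x = 0) ∧
      (∀ x ∈ closure (Set.range (P : H → H)), ‖U x‖ = ‖x‖) := by
  let K : Submodule ℂ H := (P : H →ₗ[ℂ] H).range.topologicalClosure
  have hKc : (K : Set H) = closure (Set.range (P : H → H)) := rfl
  have : CompleteSpace K := (Submodule.isClosed_topologicalClosure _).completeSpace_coe
  have hPK : ∀ x, P x ∈ K := fun x => by
    rw [← SetLike.mem_coe, hKc]; exact subset_closure ⟨x, rfl⟩
  let e : H →ₗ[ℂ] K := (P : H →ₗ[ℂ] H).codRestrict K hPK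
  have hd : DenseRange e := by
    intro ⟨y, hy⟩
    rw [closure_subtype]
    rw [← SetLike.mem_coe, hKc] at hy
    refine closure_mono ?_ hy
    rintro _ ⟨x, rfl⟩
    exact ⟨e x, ⟨x, rfl⟩, rfl⟩
  let V : K →L[ℂ] H := (T : H →ₗ[ℂ] H).extendOfNorm e
  have hV : ∀ x, V (e x) = T x := fun x =>
    LinearMap.extendOfNorm_eq hd ⟨1, fun x => by simpa [e] using (hn x).le⟩ x
  let U : H →L[ℂ] H := V.comp K.orthogonalProjectionOnto
  have hU : ∀ x, U (P x) = T x := fun x => by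
    rw [← hV]
    show V (K.orthogonalProjectionOnto (P x)) = _
    congr 1
    exact Submodule.orthogonalProjectionOnto_mem_subspace_eq_self (e x)
  refine ⟨U, hU, ?_, ?_⟩
  · intro x hx
    have : x ∈ Kᗮ := by
      rw [Submodule.orthogonal_closure, Submodule.mem_orthogonal']
      rintro _ ⟨y, rfl⟩
      exact hx y
    show V (K.orthogonalProjectionOnto x) = 0
    rw [Submodule.orthogonalProjectionOnto_apply_of_mem_orthogonal this, map_zero]
  · intro x hx
    have hcl : IsClosed {x : H | ‖U x‖ = ‖x‖} := isClosed_eq (by fun_prop) (by fun_prop)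
    refine closure_minimal ?_ hcl hx
    rintro _ ⟨y, rfl⟩
    simp [hU, hn]

/-- Polar-decomposition characterization of `C`-normal operators: `T` is `C`-normal iff
`T = C J |T|` for a partial anti-unitary `J` supported on `ran |T|` with `J |T| = |T| J`.
Here `P = |T|` is the positive square root of `T*T`. -/
theorem stmt_3 {H : Type*} [NormedAddCommGroup H] [InnerProductSpace ℂ H] [CompleteSpace H]
    [SeparableSpace H]
    (C : H → H) (hC : Conjugation C)
    (T P : H →L[ℂ] H) (hP : P.IsPositive) (hPsq : P * P = adjoint T * T) :
    CNormal C T ↔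
      ∃ J : H → H,
        (∀ (a : ℂ) (x y : H), J (a • x + y) = (starRingEnd ℂ) a • J x + J y) ∧
        (∀ x : H, (∀ y : H, ⟪x, P y⟫_ℂ = 0) → J x = 0) ∧
        (∀ x ∈ closure (Set.range (P : H → H)), ‖J x‖ = ‖x‖) ∧
        J '' closure (Set.range (P : H → H)) = closure (Set.range (P : H → H)) ∧
        (∀ x, T x = C (J (P x))) ∧
        (∀ x, J (P x) = P (J x)) := by
  obtain ⟨hC1, hC2, hC3⟩ := hC
  have hCadd : ∀ x y, C (x + y) = C x + C y := fun x y => by simpa using hC1 1 x y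
  have hC0 : C 0 = 0 := by simpa using hCadd 0 0
  have hCsmul : ∀ (a : ℂ) x, C (a • x) = (starRingEnd ℂ) a • C x := fun a x => by
    simpa [hC0] using hC1 a x 0
  have hCnorm : ∀ x, ‖C x‖ = ‖x‖ := fun x => by
    rw [@norm_eq_sqrt_re_inner ℂ, @norm_eq_sqrt_re_inner ℂ, hC3]
  have hCneg : ∀ x, C (-x) = - C x := fun x => by simpa using hCsmul (-1) x
  have hCcont : Continuous C := by
    refine (Isometry.of_dist_eq fun x y => ?_).continuous
    rw [dist_eq_norm, dist_eq_norm, ← hCnorm (x - y), sub_eq_add_neg x y, hCadd, hCneg, sub_eq_add_neg]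
  have hC4 : ∀ x y, ⟪C x, y⟫_ℂ = ⟪C y, x⟫_ℂ := fun x y => by
    rw [← hC3, hC2]
  have hPP : ∀ x, P (P x) = adjoint T (T x) := fun x => DFunLike.congr_fun hPsq x
  have hPsym : ∀ x y, ⟪P x, y⟫_ℂ = ⟪x, P y⟫_ℂ := hP.inner_left_eq_inner_right
  have hnorm : ∀ x, ‖T x‖ = ‖P x‖ := fun x => by
    rw [@norm_eq_sqrt_re_inner ℂ, @norm_eq_sqrt_re_inner ℂ, hPsym, hPP, adjoint_inner_right]
  constructor
  · intro hN
    obtain ⟨U, hU1, hU2, hU3⟩ := aux_polar T P hnorm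
    -- Q = C P C
    let Q : H →L[ℂ] H :=
      { toFun := fun x => C (P (C x))
        map_add' := fun x y => by simp [hCadd]
        map_smul' := fun a x => by simp [hCsmul]
        cont := hCcont.comp (P.continuous.comp hCcont) }
    have hQ : ∀ x, Q x = C (P (C x)) := fun x => rfl
    have hQpos : Q.IsPositive := by
      rw [isPositive_iff]
      refine ⟨fun x y => ?_, fun x => ?_⟩
      · show ⟪C (P (C x)), y⟫_ℂ = ⟪x, C (P (C y))⟫_ℂ
        rw [hC4, ← hPsym, ← hC3, hC2]
      · rw [hQ, hC4, ← hPsym]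
        exact hP.inner_nonneg_left _
    have hQT : Q * T = T * P := by
      refine aux_intertwine Q P T ((nonneg_iff_isPositive _).2 hQpos)
        ((nonneg_iff_isPositive _).2 hP) ?_
      ext x
      show C (P (C (C (P (C (T x)))))) = T (P (P x))
      rw [hC2, hPP, hN, hPP]
    have hUP : ∀ x, U (P x) = C (P (C (U x))) := by
      intro x
      let K : Submodule ℂ H := (P : H →ₗ[ℂ] H).range.topologicalClosure
      have : CompleteSpace K := (Submodule.isClosed_topologicalClosure _).completeSpace_coe
      obtain ⟨y, hy, z, hz, rfl⟩ := K.exists_add_mem_mem_orthogonal x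
      have hz' : ∀ y : H, ⟪z, P y⟫_ℂ = 0 := by
        rw [Submodule.orthogonal_closure, Submodule.mem_orthogonal'] at hz
        exact fun y => hz _ ⟨y, rfl⟩
      have hPz : P z = 0 := by
        rw [← @inner_self_eq_zero ℂ, hPsym]; exact hz' _
      rw [map_add P, map_add U y z, hPz, hU2 z hz', add_zero, add_zero]
      have hcl : IsClosed {x : H | U (P x) = Q (U x)} := isClosed_eq (by fun_prop) (by fun_prop)
      refine closure_minimal ?_ hcl hy
      rintro _ ⟨w, rfl⟩
      show U (P (P w)) = Q (U (P w))
      rw [hU1, hU1]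
      exact (DFunLike.congr_fun hQT w).symm
    have hJP : ∀ x, C (U (P x)) = P (C (U x)) := fun x => by rw [hUP, hC2]
    have hJcont : Continuous fun x => C (U x) := hCcont.comp U.continuous
    refine ⟨fun x => C (U x), ?_, ?_, ?_, ?_, ?_, hJP⟩
    · intro a x y
      simp [hC1]
    · intro x hx
      simp [hU2 x hx, hC0]
    · intro x hx
      simp [hCnorm, hU3 x hx]
    · apply Set.Subset.antisymm
      · refine (image_closure_subset_closure_image hJcont).trans (closure_mono ?_)
        rintro _ ⟨_, ⟨y, rfl⟩, rfl⟩
        exact ⟨C (U y), (hJP y).symm⟩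
      · have hclosed : IsClosed ((fun x => C (U x)) '' closure (Set.range (P : H → H))) := by
          have hiso : Isometry (fun x : closure (Set.range (P : H → H)) => C (U x)) := by
            refine Isometry.of_dist_eq fun x y => ?_
            have hsub : (x : H) - y ∈ closure (Set.range (P : H → H)) := by
              have hK : ((P : H →ₗ[ℂ] H).range.topologicalClosure : Set H)
                  = closure (Set.range (P : H → H)) := rfl
              exact Submodule.sub_mem (P : H →ₗ[ℂ] H).range.topologicalClosure x.2 y.2
            rw [Subtype.dist_eq, dist_eq_norm, dist_eq_norm, ← hU3 _ hsub, ← hCnorm (U _), map_sub,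
              sub_eq_add_neg (U x), hCadd, hCneg, sub_eq_add_neg]
          have : CompleteSpace (closure (Set.range (P : H → H))) :=
            isClosed_closure.completeSpace_coe
          have h := hiso.isClosedEmbedding.isClosed_range
          rwa [Set.image_eq_range]
        have hden : closure (Set.range (P : H → H)) ⊆
            closure (Set.range (P ∘L P : H →L[ℂ] H)) := by
          have h1 : (P ∘L P).range.topologicalClosure = P.range.topologicalClosure := by
            rw [← Submodule.orthogonal_orthogonal_eq_closure,
              ← Submodule.orthogonal_orthogonal_eq_closure,
              orthogonal_range, orthogonal_range, adjoint_comp]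
            have := ker_adjoint_comp_self P
            rw [hP.isSelfAdjoint.adjoint_eq] at this ⊢
            rw [this]
          have h2 := congrArg (fun s : Submodule ℂ H => (s : Set H)) h1
          simp only [Submodule.topologicalClosure_coe] at h2
          exact h2.symm.subset
        refine hden.trans (closure_minimal ?_ hclosed)
        rintro _ ⟨u, rfl⟩
        refine ⟨P (adjoint T (C u)), subset_closure ⟨_, rfl⟩, ?_⟩
        show C (U (P (adjoint T (C u)))) = P (P u)
        rw [hU1, ← hN, hC2, hC2, hPP]
    · intro x
      simp only [hC2, hU1]
  · rintro ⟨J, hJ1, hJ2, hJ3, hJ4, hJ5, hJ6⟩ y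
    let K : Submodule ℂ H := (P : H →ₗ[ℂ] H).range.topologicalClosure
    have hKc : (K : Set H) = closure (Set.range (P : H → H)) := rfl
    have : CompleteSpace K := (Submodule.isClosed_topologicalClosure _).completeSpace_coe
    have hJadd : ∀ x y, J (x + y) = J x + J y := fun x y => by simpa using hJ1 1 x y
    have hJ0 : J 0 = 0 := by simpa using hJadd 0 0
    have hJsmul : ∀ (a : ℂ) x, J (a • x) = (starRingEnd ℂ) a • J x := fun a x => by
      simpa [hJ0] using hJ1 a x 0
    let W : K →ₗᵢ[ℂ] H :=
      { toFun := fun x => C (J x)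
        map_add' := fun x y => by simp [hCadd, hJadd]
        map_smul' := fun a x => by simp [hCsmul, hJsmul]
        norm_map' := fun x => by
          show ‖C (J x)‖ = ‖x‖
          rw [hCnorm, hJ3 _ (hKc ▸ x.2)]; rfl }
    have hin : ∀ x ∈ K, ∀ z ∈ K, ⟪J z, J x⟫_ℂ = ⟪x, z⟫_ℂ := by
      intro x hx z hz
      have := W.inner_map_map ⟨x, hx⟩ ⟨z, hz⟩
      rw [← hC3]
      exact this
    have hin2 : ∀ x, ∀ z ∈ K, ⟪J z, J x⟫_ℂ = ⟪x, z⟫_ℂ := by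
      intro x z hz
      obtain ⟨u, hu, v, hv, rfl⟩ := K.exists_add_mem_mem_orthogonal x
      have hv' : ⟪v, z⟫_ℂ = 0 := (Submodule.mem_orthogonal' _ _).1 hv z hz
      have hJv : J v = 0 := by
        refine hJ2 v fun y => ?_
        exact (Submodule.mem_orthogonal' _ _).1 hv _ (by
          rw [← SetLike.mem_coe, hKc]; exact subset_closure ⟨y, rfl⟩)
      rw [hJadd, hJv, add_zero, inner_add_left, hv', add_zero, hin u hu z hz]
    obtain ⟨z, hz, hzy⟩ : P (C y) ∈ J '' closure (Set.range (P : H → H)) := by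
      rw [hJ4]; exact subset_closure ⟨_, rfl⟩
    have hTz : adjoint T y = z := by
      refine ext_inner_left ℂ fun x => ?_
      rw [adjoint_inner_right, hJ5, hC4, hJ6, ← hPsym, ← hzy]
      exact hin2 x z (by rw [← SetLike.mem_coe, hKc]; exact hz)
    rw [hTz, hJ5 z, hJ6, hzy, hPP]
end

section
/- Let H be a separable complex Hilbert space, C a conjugation on H, and T a bounded linear operator on H. Then T is C-normal if and only if there exist a positive bounded linear operator P on H and an anti-unitary operator J on H (an anti-linear bijective map with ⟨Jx, Jy⟩ = ⟨y, x⟩ for all x, y) such that J ∘ P = P ∘ J and T = C ∘ J ∘ P. -/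
open scoped InnerProductSpace
open ContinuousLinearMap TopologicalSpace

section Aux
variable {H : Type*} [NormedAddCommGroup H] [InnerProductSpace ℂ H] [CompleteSpace H]

lemma aux_zero {C : H → H} (hC : ∀ (a : ℂ) (x y : H), C (a • x + y) = (starRingEnd ℂ) a • C x + C y) :
    C 0 = 0 := by
  have := hC 1 0 0
  simpa using this

lemma aux_norm {C : H → H} (hC : ∀ x y : H, ⟪C x, C y⟫_ℂ = ⟪y, x⟫_ℂ) (x : H) : ‖C x‖ = ‖x‖ := by
  rw [@norm_eq_sqrt_re_inner ℂ, @norm_eq_sqrt_re_inner ℂ _ _ _ _ x, hC]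

lemma aux_ker (T : H →L[ℂ] H) (x : H) (h : adjoint T (T x) = 0) : T x = 0 := by
  have : ⟪T x, T x⟫_ℂ = 0 := by rw [← adjoint_inner_left, h, inner_zero_left]
  exact inner_self_eq_zero.1 this

lemma aux_ker' (T : H →L[ℂ] H) (x : H) (h : T (adjoint T x) = 0) : adjoint T x = 0 := by
  apply aux_ker
  rwa [adjoint_adjoint]

lemma aux_swap {C : H → H} (hC : Conjugation C) (x y : H) : ⟪C x, y⟫_ℂ = ⟪C y, x⟫_ℂ := by
  have := hC.2.2 x (C y)
  rwa [hC.2.1] at this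

/-- identification of the kernels -/
lemma aux_kerEquiv {C : H → H} (hC : Conjugation C) (T : H →L[ℂ] H) (h : CNormal C T) :
    Nonempty (T.ker ≃ₗᵢ[ℂ] (adjoint T).ker) := by
  have hker1 : ∀ x, T x = 0 → adjoint T (C x) = 0 := by
    intro x hx
    apply aux_ker'
    rw [← h, hC.2.1, hx, map_zero, aux_zero hC.1]
  have hker2 : ∀ x, adjoint T x = 0 → T (C x) = 0 := by
    intro x hx
    apply aux_ker
    have h1 := h x
    rw [hx, map_zero] at h1
    rw [← hC.2.1 (adjoint T _), h1, aux_zero hC.1]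
  have : CompleteSpace T.ker := T.isClosed_ker.completeSpace_coe
  have : CompleteSpace (adjoint T).ker := (adjoint T).isClosed_ker.completeSpace_coe
  obtain ⟨w, b, -⟩ := exists_hilbertBasis ℂ T.ker
  let v : w → (adjoint T).ker := fun i => ⟨C (b i), hker1 _ (b i).2⟩
  have hv : Orthonormal ℂ v := by
    have hb := b.orthonormal
    classical
    rw [orthonormal_iff_ite] at hb ⊢
    intro i j
    have := hb j i
    rw [Submodule.coe_inner] at this ⊢
    rw [hC.2.2, this]
    simp [eq_comm]
  have hsp : (Submodule.span ℂ (Set.range v))ᗮ = ⊥ := by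
    rw [Submodule.eq_bot_iff]
    intro y hy
    have h1 : ∀ i, ⟪v i, y⟫_ℂ = 0 := fun i =>
      (Submodule.mem_orthogonal _ _).1 hy _ (Submodule.subset_span ⟨i, rfl⟩)
    let z : T.ker := ⟨C y, hker2 _ y.2⟩
    have hz : z = 0 := by
      apply b.repr.injective
      ext i
      rw [b.repr_apply_apply, Submodule.coe_inner]
      have h2 := h1 i
      rw [Submodule.coe_inner] at h2
      have h3 : ⟪(b i : H), C y⟫_ℂ = 0 := by
        rw [← inner_conj_symm, aux_swap hC, h2, map_zero]
      rw [h3]; simp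
    have hz' : C y = 0 := congrArg Subtype.val hz
    apply Subtype.ext
    rw [← hC.2.1 (y : H), hz', aux_zero hC.1]
    rfl
  let b' := HilbertBasis.mkOfOrthogonalEqBot hv hsp
  exact ⟨b.repr.trans b'.repr.symm⟩

lemma aux_polar_s11 {C : H → H} (hC : Conjugation C) (T P : H →L[ℂ] H) (h : CNormal C T)
    (hPs : adjoint P = P) (hPT : ∀ x, P (P x) = adjoint T (T x)) :
    ∃ U : H ≃ₗᵢ[ℂ] H, ∀ x, U (P x) = T x := by
  obtain ⟨V⟩ := aux_kerEquiv hC T h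
  have hTP : ∀ x, ‖T x‖ = ‖P x‖ := by
    intro x
    have : ⟪T x, T x⟫_ℂ = ⟪P x, P x⟫_ℂ := by
      rw [← adjoint_inner_left T, ← adjoint_inner_left P, hPs, hPT]
    rw [@norm_eq_sqrt_re_inner ℂ, @norm_eq_sqrt_re_inner ℂ _ _ _ _ (P x), this]
  have hkP : ∀ x, T x = 0 ↔ P x = 0 := fun x => by
    rw [← norm_eq_zero, hTP, norm_eq_zero]
  let e : (H × T.ker) →ₗ[ℂ] H := LinearMap.coprod (P : H →ₗ[ℂ] H) T.ker.subtype
  let f : (H × T.ker) →ₗ[ℂ] H := LinearMap.coprod (T : H →ₗ[ℂ] H)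
    ((adjoint T).ker.subtype ∘ₗ (V.toLinearEquiv : T.ker →ₗ[ℂ] (adjoint T).ker))
  have he : ∀ x k, e (x, k) = P x + k := fun x k => by simp [e]
  have hf : ∀ x k, f (x, k) = T x + (V k : H) := fun x k => by simp [f]
  have hnorm : ∀ z, ‖f z‖ = ‖e z‖ := by
    rintro ⟨x, k⟩
    rw [he, hf]
    have o1 : ⟪P x, (k : H)⟫_ℂ = 0 := by
      rw [← hPs, adjoint_inner_left, (hkP _).1 k.2, inner_zero_right]
    have o2 : ⟪T x, (V k : H)⟫_ℂ = 0 := by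
      have : adjoint T (V k : H) = 0 := (V k).2
      rw [← adjoint_inner_right, this, inner_zero_right]
    have n1 := norm_add_sq_eq_norm_sq_add_norm_sq_of_inner_eq_zero _ _ o1
    have n2 := norm_add_sq_eq_norm_sq_add_norm_sq_of_inner_eq_zero _ _ o2
    have n3 : ‖(V k : H)‖ = ‖(k : H)‖ := V.norm_map k
    rw [hTP, n3, ← n1] at n2
    exact (mul_self_inj_of_nonneg (norm_nonneg _) (norm_nonneg _)).1 n2
  have dense_of : ∀ g : (H × T.ker) →ₗ[ℂ] H, (∀ y, (∀ z, ⟪g z, y⟫_ℂ = 0) → y = 0) → DenseRange g := by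
    intro g hg
    have : (LinearMap.range g)ᗮ = ⊥ := by
      rw [Submodule.eq_bot_iff]
      intro y hy
      exact hg y fun z => (Submodule.mem_orthogonal _ _).1 hy _ ⟨z, rfl⟩
    rw [← Submodule.topologicalClosure_eq_top_iff] at this
    have h2 := Submodule.dense_iff_topologicalClosure_eq_top.2 this
    exact h2
  have hed : DenseRange e := by
    apply dense_of
    intro y hy
    have h1 : P y = 0 := by
      have := hy (P y, 0)
      rw [he] at this
      simp only [Submodule.coe_zero, add_zero] at this
      rw [← adjoint_inner_right, hPs] at this
      exact inner_self_eq_zero.1 this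
    have h2 := hy (0, ⟨y, (hkP _).2 h1⟩)
    rw [he, map_zero, zero_add] at h2
    exact inner_self_eq_zero.1 h2
  have hfd : DenseRange f := by
    apply dense_of
    intro y hy
    have h1 : adjoint T y = 0 := by
      have := hy (adjoint T y, 0)
      rw [hf] at this
      simp only [map_zero, Submodule.coe_zero, add_zero] at this
      rw [← adjoint_inner_right] at this
      exact inner_self_eq_zero.1 this
    have h2 := hy (0, V.symm ⟨y, h1⟩)
    rw [hf, map_zero, zero_add, V.apply_symm_apply] at h2
    exact inner_self_eq_zero.1 h2
  have hb : ∃ c : ℝ, ∀ x, ‖f x‖ ≤ c * ‖e x‖ := ⟨1, fun x => by rw [hnorm, one_mul]⟩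
  let U := f.extendOfNorm e
  have hU : ∀ z, U (e z) = f z := LinearMap.extendOfNorm_eq hed hb
  have hUn : ∀ x, ‖U x‖ = ‖x‖ := by
    intro x
    refine hed.induction_on (p := fun x => ‖U x‖ = ‖x‖) x
      (isClosed_eq (by fun_prop) (by fun_prop)) ?_
    intro z
    rw [hU, hnorm]
  let Ui : H →ₗᵢ[ℂ] H := ⟨U.toLinearMap, hUn⟩
  have hs : Function.Surjective Ui := by
    have hc : IsClosed (Set.range Ui) := Ui.isometry.isClosedEmbedding.isClosed_range
    have hd : Dense (Set.range Ui) := hfd.mono (by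
      rintro _ ⟨z, rfl⟩
      exact ⟨e z, hU z⟩)
    rw [← Set.range_eq_univ, ← hc.closure_eq, hd.closure_eq]
  refine ⟨LinearIsometryEquiv.ofSurjective Ui hs, fun x => ?_⟩
  have := hU (x, 0)
  rw [he, hf] at this
  simp only [map_zero, Submodule.coe_zero, add_zero] at this
  exact this

/-- `C P C` as a linear operator -/
noncomputable def conjOp {C : H → H} (hC : Conjugation C) (P : H →L[ℂ] H) : H →L[ℂ] H :=
  LinearMap.mkContinuous
    (IsLinearMap.mk' (fun x => C (P (C x)))
      { map_add := fun x y => by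
          have ha : ∀ x y, C (x + y) = C x + C y := fun x y => by simpa using hC.1 1 x y
          simp [ha]
        map_smul := fun a x => by
          have ha : ∀ (a : ℂ) x, C (a • x) = (starRingEnd ℂ) a • C x := fun a x => by
            simpa [aux_zero hC.1] using hC.1 a x 0
          simp [ha] })
    ‖P‖ (fun x => by
      simp only [IsLinearMap.mk'_apply]
      rw [aux_norm hC.2.2, ← aux_norm hC.2.2 x]
      exact P.le_opNorm _)

lemma conjOp_apply {C : H → H} (hC : Conjugation C) (P : H →L[ℂ] H) (x : H) :
    conjOp hC P x = C (P (C x)) := rfl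

lemma conjOp_pos {C : H → H} (hC : Conjugation C) (P : H →L[ℂ] H) (hP : P.IsPositive) :
    (conjOp hC P).IsPositive := by
  rw [isPositive_iff_complex] at hP ⊢
  intro x
  have : ⟪conjOp hC P x, x⟫_ℂ = ⟪C x, P (C x)⟫_ℂ := by
    rw [conjOp_apply, aux_swap hC]
  rw [this, ← inner_conj_symm]
  obtain ⟨h1, h2⟩ := hP (C x)
  rw [← h1]
  simpa using h2

end Aux

theorem stmt_11 {H : Type*} [NormedAddCommGroup H] [InnerProductSpace ℂ H] [CompleteSpace H]
    [SeparableSpace H]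
    (C : H → H) (hC : Conjugation C) (T : H →L[ℂ] H) :
    CNormal C T ↔
      ∃ (P : H →L[ℂ] H) (J : H → H),
        P.IsPositive ∧
        (∀ (a : ℂ) (x y : H), J (a • x + y) = (starRingEnd ℂ) a • J x + J y) ∧
        Function.Surjective J ∧
        (∀ x y : H, ⟪J x, J y⟫_ℂ = ⟪y, x⟫_ℂ) ∧
        (∀ x, J (P x) = P (J x)) ∧
        (∀ x, T x = C (J (P x))) := by
  constructor
  · intro h
    obtain ⟨P, hP, hPT⟩ : ∃ P : H →L[ℂ] H, 0 ≤ P ∧ P * P = star T * T :=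
      ⟨CFC.abs T, CFC.abs_nonneg T, CFC.abs_mul_abs T⟩
    have hPp : P.IsPositive := (nonneg_iff_isPositive _).1 hP
    have hPs : adjoint P = P := hPp.isSelfAdjoint.adjoint_eq
    have hPT' : ∀ x, P (P x) = adjoint T (T x) := fun x => congrArg (fun A : H →L[ℂ] H => A x) hPT
    obtain ⟨U, hU⟩ := aux_polar_s11 hC T P h hPs hPT'
    let u : H →L[ℂ] H := (U : H →L[ℂ] H)
    have hmul : ∀ (A B : H →L[ℂ] H) (x : H), (A * B) x = A (B x) := fun _ _ _ => rfl
    have hu : ∀ x, u x = U x := fun x => rfl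
    have hua : ∀ x, adjoint u x = U.symm x := by
      intro x
      refine ext_inner_right ℂ fun y => ?_
      rw [adjoint_inner_left, hu, ← U.symm.inner_map_map, U.symm_apply_apply]
    have hTa : ∀ x, adjoint T x = P (U.symm x) := by
      intro x
      refine ext_inner_right ℂ fun y => ?_
      rw [adjoint_inner_left, ← hU, ← U.symm.inner_map_map, U.symm_apply_apply,
        ← adjoint_inner_left, hPs]
    have hQ : conjOp hC P = u * P * adjoint u := by
      have hp2 : 0 ≤ u * P * adjoint u := by
        rw [nonneg_iff_isPositive]
        exact hPp.conj_adjoint u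
      rw [← CFC.mul_self_eq_mul_self_iff _ _ ((nonneg_iff_isPositive _).2 (conjOp_pos hC P hPp)) hp2]
      ext x
      simp only [hmul, conjOp_apply, hC.2.1, hua, hu, U.symm_apply_apply]
      rw [hPT', h, hTa, ← hU]
    refine ⟨P, fun x => C (U x), hPp, ?_, ?_, ?_, ?_, ?_⟩
    · intro a x y
      simp [hC.1]
    · intro y
      exact ⟨U.symm (C y), by simp [hC.2.1]⟩
    · intro x y
      rw [hC.2.2, U.inner_map_map]
    · intro x
      have := congrArg (fun A : H →L[ℂ] H => A (U x)) hQ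
      simp only [hmul, conjOp_apply, hua, hu, U.symm_apply_apply] at this
      simp only
      rw [← this, hC.2.1]
    · intro x
      simp only [hC.2.1, hU]
  · rintro ⟨P, J, hP, hJl, hJs, hJ, hJP, hT⟩ x
    have hPs : adjoint P = P := hP.isSelfAdjoint.adjoint_eq
    have h1 : ∀ x, adjoint T (T x) = P (P x) := by
      intro x
      refine ext_inner_right ℂ fun y => ?_
      rw [adjoint_inner_left, hT, hT, hC.2.2, hJ, ← adjoint_inner_left, hPs]
    obtain ⟨w, hw⟩ := hJs (C x)
    have hx : x = C (J w) := by rw [hw, hC.2.1]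
    have h2 : adjoint T x = P w := by
      refine ext_inner_right ℂ fun y => ?_
      rw [adjoint_inner_left, hT, hx, hC.2.2, hJ, ← adjoint_inner_left, hPs]
    rw [h1, h2, hT, hJP, hJP, hw]
end
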